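/- For natural numbers n and m: n ≠ m if and only if there exists a relation A : ℕ → ℕ → Prop with A n m such that for all k, l with A k l one has ¬(k = 0 ∧ l = 0) and, for all k', l', if k = k' + 1 and l = l' + 1 then A k' l'. (That is, on the natural numbers the strong negation of the similarity relation — the greatest fixed point of the negated clauses of the inductive equality on ℕ — coincides with inequality.) -/

import Mathlib

theorem ne_iff_strong_neg_similarity (n m : ℕ) :
    n ≠ m ↔ ∃ A : ℕ → ℕ → Prop, A n m ∧
      ∀ k l, A k l → ¬(k = 0 ∧ l = 0) ∧
        ∀ k' l', k = k' + 1 → l = l' + 1 → A k' l' := by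
  constructor
  · intro h
    exact ⟨fun k l => k ≠ l, h, fun k l hkl => ⟨by omega, fun k' l' hk hl => by omega⟩⟩
  · rintro ⟨A, hA, hclosed⟩ rfl
    induction n with
    | zero => exact (hclosed 0 0 hA).1 ⟨rfl, rfl⟩
    | succ n ih => exact ih ((hclosed _ _ hA).2 n n rfl rfl)
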